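/- arXiv:2504.10516 — 2 statements merged into one kernel-verified Lean document; each statement's English description precedes it below -/
import Mathlib

section
/- (Lemma S1) For any odd integer d ≥ 3 and any three phase-space point operators A^r, A^w, A^v with r, w, v ∈ (ZMod d)², the real part of the trace of their product satisfies Re(Tr[A^r A^w A^v]) ≤ 1. -/
open Matrix

noncomputable section

/-- ω = exp(2πi/d). -/
def wUnit (d : ℕ) : ℂ := Complex.exp (2 * (Real.pi : ℂ) * Complex.I / d)

/-- τ = exp((d+1)πi/d). -/
def tUnit (d : ℕ) : ℂ := Complex.exp (((d : ℂ) + 1) * (Real.pi : ℂ) * Complex.I / d)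

/-- The shift operator, X|k⟩ = |k+1⟩. -/
def shiftX (d : ℕ) : Matrix (ZMod d) (ZMod d) ℂ :=
  Matrix.of fun i j => if i = j + 1 then 1 else 0

/-- The clock operator, Z|k⟩ = ω^k |k⟩. -/
def clockZ (d : ℕ) : Matrix (ZMod d) (ZMod d) ℂ :=
  Matrix.of fun i j => if i = j then wUnit d ^ j.val else 0

/-- The Heisenberg-Weyl operator T_u = τ^{-a₁a₂} Z^{a₁} X^{a₂}. -/
def HW (d : ℕ) [NeZero d] (u : ZMod d × ZMod d) : Matrix (ZMod d) (ZMod d) ℂ :=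
  tUnit d ^ (-(u.1 * u.2)).val • (clockZ d ^ (u.1).val * shiftX d ^ (u.2).val)

/-- The phase space point operator at the origin, A^0 = (1/d) Σ_u T_u. -/
def A0 (d : ℕ) [NeZero d] : Matrix (ZMod d) (ZMod d) ℂ :=
  (1 / (d : ℂ)) • ∑ u : ZMod d × ZMod d, HW d u

/-- The phase space point operator A^u = T_u A^0 (T_u)†. -/
def Apt (d : ℕ) [NeZero d] (u : ZMod d × ZMod d) : Matrix (ZMod d) (ZMod d) ℂ :=
  HW d u * A0 d * (HW d u)ᴴ

lemma wUnit_pow_eq_stdAddChar (d : ℕ) [NeZero d] (n : ℕ) :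
    wUnit d ^ n = ZMod.stdAddChar (n : ZMod d) := by
  have h := ZMod.stdAddChar_coe (N := d) (n : ℤ)
  push_cast at h
  rw [h, wUnit, ← Complex.exp_nat_mul]
  congr 1
  ring

lemma tUnit_eq_wUnit_pow (k : ℕ) : tUnit (2 * k + 1) = wUnit (2 * k + 1) ^ (k + 1) := by
  rw [tUnit, wUnit, ← Complex.exp_nat_mul]
  congr 1
  push_cast
  ring

lemma tUnit_pow_eq_stdAddChar (k n : ℕ) :
    tUnit (2 * k + 1) ^ n =
      ZMod.stdAddChar (((k : ZMod (2 * k + 1)) + 1) * (n : ZMod (2 * k + 1))) := by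
  rw [tUnit_eq_wUnit_pow, ← pow_mul, wUnit_pow_eq_stdAddChar]
  push_cast
  rfl

lemma two_mul_succ_eq_one (k : ℕ) : 2 * ((k : ZMod (2 * k + 1)) + 1) = 1 := by
  have h : ((2 * k + 1 : ℕ) : ZMod (2 * k + 1)) = 0 := ZMod.natCast_self _
  push_cast at h
  linear_combination h

lemma shiftX_pow_apply (d : ℕ) [NeZero d] (n : ℕ) (i j : ZMod d) :
    (shiftX d ^ n) i j = if i = j + n then 1 else 0 := by
  induction n generalizing i j with
  | zero => simp [Matrix.one_apply]
  | succ n ih =>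
    rw [pow_succ, Matrix.mul_apply, Finset.sum_eq_single (j + 1)]
    · rw [ih]
      simp [shiftX, add_assoc, add_comm (1 : ZMod d)]
    · intro b _ hb
      simp [shiftX, hb]
    · simp

lemma clockZ_pow (d : ℕ) [NeZero d] (n : ℕ) :
    clockZ d ^ n = Matrix.diagonal fun i : ZMod d => wUnit d ^ (i.val * n) := by
  have h : clockZ d = Matrix.diagonal fun i : ZMod d => wUnit d ^ i.val := by
    ext i j
    by_cases hij : i = j <;> simp [clockZ, hij]
  rw [h, Matrix.diagonal_pow]
  congr 1
  ext i
  simp [pow_mul]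

/-- Entries of a Heisenberg–Weyl operator, with `k + 1` the inverse of `2` modulo `2 * k + 1`. -/
lemma HW_apply (k : ℕ) (u : ZMod (2 * k + 1) × ZMod (2 * k + 1)) (i j : ZMod (2 * k + 1)) :
    HW (2 * k + 1) u i j =
      if i = j + u.2 then ZMod.stdAddChar (((k : ZMod (2 * k + 1)) + 1) * -(u.1 * u.2) + i * u.1)
      else 0 := by
  rw [HW, clockZ_pow, Matrix.smul_apply, Matrix.diagonal_mul, shiftX_pow_apply,
    tUnit_pow_eq_stdAddChar, wUnit_pow_eq_stdAddChar]
  simp [AddChar.map_add_eq_mul]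

/-- The phase-space point operator at the origin is the parity operator. -/
lemma A0_apply (k : ℕ) (i j : ZMod (2 * k + 1)) :
    A0 (2 * k + 1) i j = if i + j = 0 then 1 else 0 := by
  have h2 := two_mul_succ_eq_one k
  have hsum : ∑ u : ZMod (2 * k + 1) × ZMod (2 * k + 1), HW (2 * k + 1) u i j =
      ∑ a : ZMod (2 * k + 1),
        (ZMod.stdAddChar (a * (((k : ZMod (2 * k + 1)) + 1) * (i + j))) : ℂ) := by
    rw [Fintype.sum_prod_type]
    refine Finset.sum_congr rfl fun a _ => ?_
    rw [Finset.sum_eq_single (i - j)]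
    · rw [HW_apply, if_pos (by simp)]
      congr 1
      linear_combination (-(i * a)) * h2
    · intro b _ hb
      rw [HW_apply, if_neg]
      rintro rfl
      simp at hb
    · simp
  have hiff : ((k : ZMod (2 * k + 1)) + 1) * (i + j) = 0 ↔ i + j = 0 :=
    ⟨fun h => by linear_combination 2 * h - (i + j) * h2, fun h => by simp [h]⟩
  rw [A0, Matrix.smul_apply, Matrix.sum_apply, hsum,
    AddChar.sum_mulShift _ (ZMod.isPrimitive_stdAddChar _)]
  have hd : (2 * (k : ℂ) + 1) ≠ 0 := by exact_mod_cast (2 * k).succ_ne_zero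
  by_cases h : i + j = 0
  · simp [h, ZMod.card, hd]
  · simp [h, hiff]

lemma Apt_apply (k : ℕ) (u : ZMod (2 * k + 1) × ZMod (2 * k + 1)) (i j : ZMod (2 * k + 1)) :
    Apt (2 * k + 1) u i j =
      HW (2 * k + 1) u i (i - u.2) * A0 (2 * k + 1) (i - u.2) (j - u.2) *
        star (HW (2 * k + 1) u j (j - u.2)) := by
  have hHW (i b : ZMod (2 * k + 1)) (hb : b ≠ i - u.2) : HW (2 * k + 1) u i b = 0 := by
    rw [HW_apply, if_neg]
    rintro rfl
    simp at hb
  rw [Apt, Matrix.mul_apply, Finset.sum_eq_single (j - u.2), Matrix.mul_apply,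
    Finset.sum_eq_single (i - u.2), Matrix.conjTranspose_apply]
  · intro b _ hb
    rw [hHW i b hb, zero_mul]
  · simp
  · intro b _ hb
    rw [Matrix.conjTranspose_apply, hHW j b hb, star_zero, mul_zero]
  · simp

lemma norm_HW_apply_le_one (k : ℕ) (u : ZMod (2 * k + 1) × ZMod (2 * k + 1))
    (i j : ZMod (2 * k + 1)) : ‖HW (2 * k + 1) u i j‖ ≤ 1 := by
  rw [HW_apply]
  split_ifs <;> simp

lemma norm_Apt_apply_le_one (k : ℕ) (u : ZMod (2 * k + 1) × ZMod (2 * k + 1))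
    (i j : ZMod (2 * k + 1)) : ‖Apt (2 * k + 1) u i j‖ ≤ 1 := by
  have hA0 : ‖A0 (2 * k + 1) (i - u.2) (j - u.2)‖ ≤ 1 := by
    rw [A0_apply]
    split_ifs <;> simp
  rw [Apt_apply, norm_mul, norm_mul, norm_star]
  exact mul_le_one₀ (mul_le_one₀ (norm_HW_apply_le_one k u _ _) (norm_nonneg _) hA0)
    (norm_nonneg _) (norm_HW_apply_le_one k u _ _)

lemma Apt_apply_eq_zero (k : ℕ) (u : ZMod (2 * k + 1) × ZMod (2 * k + 1))
    {i j : ZMod (2 * k + 1)} (hij : j ≠ 2 * u.2 - i) : Apt (2 * k + 1) u i j = 0 := by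
  rw [Apt_apply, A0_apply, if_neg, mul_zero, zero_mul]
  exact fun h => hij (by linear_combination h)

lemma trace_Apt_mul_Apt_mul_Apt (k : ℕ) (r w v : ZMod (2 * k + 1) × ZMod (2 * k + 1)) :
    (Apt (2 * k + 1) r * Apt (2 * k + 1) w * Apt (2 * k + 1) v).trace =
      Apt (2 * k + 1) r (r.2 - w.2 + v.2) (r.2 + w.2 - v.2) *
        Apt (2 * k + 1) w (r.2 + w.2 - v.2) (w.2 + v.2 - r.2) *
        Apt (2 * k + 1) v (w.2 + v.2 - r.2) (r.2 - w.2 + v.2) := by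
  have h2 := two_mul_succ_eq_one k
  have hmul (i j : ZMod (2 * k + 1)) : (Apt (2 * k + 1) r * Apt (2 * k + 1) w) i j =
      Apt (2 * k + 1) r i (2 * r.2 - i) * Apt (2 * k + 1) w (2 * r.2 - i) j := by
    rw [Matrix.mul_apply, Finset.sum_eq_single (2 * r.2 - i)]
    · intro b _ hb
      rw [Apt_apply_eq_zero k r hb, zero_mul]
    · simp
  have hdiag (i : ZMod (2 * k + 1)) :
      (Apt (2 * k + 1) r * Apt (2 * k + 1) w * Apt (2 * k + 1) v) i i =
        Apt (2 * k + 1) r i (2 * r.2 - i) *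
          Apt (2 * k + 1) w (2 * r.2 - i) (2 * w.2 - (2 * r.2 - i)) *
          Apt (2 * k + 1) v (2 * w.2 - (2 * r.2 - i)) i := by
    rw [Matrix.mul_apply, Finset.sum_eq_single (2 * w.2 - (2 * r.2 - i)), hmul]
    · intro b _ hb
      rw [hmul, Apt_apply_eq_zero k w hb, mul_zero, zero_mul]
    · simp
  rw [Matrix.trace, Finset.sum_eq_single (r.2 - w.2 + v.2), Matrix.diag_apply, hdiag]
  · rw [show 2 * r.2 - (r.2 - w.2 + v.2) = r.2 + w.2 - v.2 by ring,
      show 2 * w.2 - (r.2 + w.2 - v.2) = w.2 + v.2 - r.2 by ring]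
  · intro i _ hi
    rw [Matrix.diag_apply, hdiag, Apt_apply_eq_zero k v, mul_zero]
    intro h
    apply hi
    linear_combination ((k : ZMod (2 * k + 1)) + 1) * h - (i - (r.2 - w.2 + v.2)) * h2
  · simp

/-- Lemma S1: Re(Tr[A^r A^w A^v]) ≤ 1 for any three phase-space point operators. -/
theorem re_trace_triple_product_le_one
    (d : ℕ) [NeZero d] (hd : 3 ≤ d) (hodd : Odd d) (r w v : ZMod d × ZMod d) :
    ((Apt d r * Apt d w * Apt d v).trace).re ≤ 1 := by
  obtain ⟨k, rfl⟩ := hodd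
  refine (Complex.re_le_norm _).trans ?_
  rw [trace_Apt_mul_Apt_mul_Apt, norm_mul, norm_mul]
  exact mul_le_one₀ (mul_le_one₀ (norm_Apt_apply_le_one k r _ _) (norm_nonneg _)
    (norm_Apt_apply_le_one k w _ _)) (norm_nonneg _) (norm_Apt_apply_le_one k v _ _)
end
end

section
/- For every integer d ≥ 2 and every δ ∈ [0,1], the operator λ₀·R^{T₃} − Q^{T₃} + C^{T₃} on (ℂ^d)^{⊗3} is positive semidefinite. -/
open Matrix ComplexOrder

noncomputable section

/-- Index type for (ℂ^d)^{⊗3}. -/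
abbrev Idx (d : ℕ) := Fin 3 → Fin d

/-- The operator on (ℂ^d)^{⊗3} permuting the tensor factors according to c ∈ S₃:
P(c)(v₁⊗v₂⊗v₃) = v_{c⁻¹(1)}⊗v_{c⁻¹(2)}⊗v_{c⁻¹(3)}. -/
def Perm3 (d : ℕ) (c : Equiv.Perm (Fin 3)) : Matrix (Idx d) (Idx d) ℂ :=
  Matrix.of fun i j => if ∀ k, i k = j (c⁻¹ k) then 1 else 0

/-- The projector onto the symmetric subspace of (ℂ^d)^{⊗3}. -/
def projSym3 (d : ℕ) : Matrix (Idx d) (Idx d) ℂ :=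
  ((6 : ℂ))⁻¹ • ∑ c : Equiv.Perm (Fin 3), Perm3 d c

/-- The depolarizing map 𝒟_δ applied to tensor factor s of an operator on (ℂ^d)^{⊗3}. -/
def depOn (d : ℕ) (δ : ℝ) (s : Fin 3) (M : Matrix (Idx d) (Idx d) ℂ) :
    Matrix (Idx d) (Idx d) ℂ :=
  Matrix.of fun i j => (1 - (δ : ℂ)) * M i j +
    ((δ : ℂ) / d) *
      (if i s = j s then ∑ k : Fin d, M (Function.update i s k) (Function.update j s k) else 0)

/-- D(n,d) = binom(n+d−1, n), the dimension of the symmetric subspace. -/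
def Dnd (n d : ℕ) : ℕ := Nat.choose (n + d - 1) n

/-- Q = (𝒟_δ⊗𝒟_δ⊗id)(Π₃)/D(3,d). -/
def Qop (d : ℕ) (δ : ℝ) : Matrix (Idx d) (Idx d) ℂ :=
  ((Dnd 3 d : ℂ))⁻¹ • depOn d δ 0 (depOn d δ 1 (projSym3 d))

/-- R = ((𝒟_δ⊗𝒟_δ)(Π₂)/D(2,d)) ⊗ I_d, using Π₂ ⊗ I = (I + P((12)))/2 on (ℂ^d)^{⊗3}. -/
def Rop (d : ℕ) (δ : ℝ) : Matrix (Idx d) (Idx d) ℂ :=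
  ((Dnd 2 d : ℂ))⁻¹ •
    depOn d δ 0 (depOn d δ 1 (((2 : ℂ))⁻¹ • (1 + Perm3 d (Equiv.swap 0 1))))

/-- The partial transpose on the third tensor factor:
(M^{T₃})_{(i₁i₂i₃),(j₁j₂j₃)} = M_{(i₁i₂j₃),(j₁j₂i₃)}. -/
def pt3 (d : ℕ) (M : Matrix (Idx d) (Idx d) ℂ) : Matrix (Idx d) (Idx d) ℂ :=
  Matrix.of fun i j => M (Function.update i 2 (j 2)) (Function.update j 2 (i 2))

/-! ### Linearity of the depolarizing and partial transpose maps -/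

lemma depOn_add (d : ℕ) (δ : ℝ) (s : Fin 3) (M N : Matrix (Idx d) (Idx d) ℂ) :
    depOn d δ s (M + N) = depOn d δ s M + depOn d δ s N := by
  ext i j
  by_cases h : i s = j s <;> simp [depOn, h, Finset.sum_add_distrib] <;> ring

lemma depOn_smul (d : ℕ) (δ : ℝ) (s : Fin 3) (z : ℂ) (M : Matrix (Idx d) (Idx d) ℂ) :
    depOn d δ s (z • M) = z • depOn d δ s M := by
  ext i j
  by_cases h : i s = j s <;> simp [depOn, h, ← Finset.mul_sum] <;> ring

lemma pt3_add (d : ℕ) (M N : Matrix (Idx d) (Idx d) ℂ) :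
    pt3 d (M + N) = pt3 d M + pt3 d N := rfl

lemma pt3_sub (d : ℕ) (M N : Matrix (Idx d) (Idx d) ℂ) :
    pt3 d (M - N) = pt3 d M - pt3 d N := rfl

lemma pt3_smul {K : Type*} [SMul K ℂ] (d : ℕ) (z : K) (M : Matrix (Idx d) (Idx d) ℂ) :
    pt3 d (z • M) = z • pt3 d M := rfl

/-! ### Entries of the permutation operators -/

section Entries

variable (d : ℕ) (i j : Idx d)

lemma one_entry : (1 : Matrix (Idx d) (Idx d) ℂ) i j =
    if i 0 = j 0 ∧ i 1 = j 1 ∧ i 2 = j 2 then 1 else 0 := by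
  simp [Matrix.one_apply, funext_iff, Fin.forall_fin_succ]

lemma Perm3_swap01_entry : Perm3 d (Equiv.swap 0 1) i j =
    if i 0 = j 1 ∧ i 1 = j 0 ∧ i 2 = j 2 then 1 else 0 := by
  have h : (Equiv.swap (0 : Fin 3) 1) 2 = 2 := by decide
  simp [Perm3, Fin.forall_fin_succ, h]

lemma Perm3_swap02_entry : Perm3 d (Equiv.swap 0 2) i j =
    if i 0 = j 2 ∧ i 1 = j 1 ∧ i 2 = j 0 then 1 else 0 := by
  have h : (Equiv.swap (0 : Fin 3) 2) 1 = 1 := by decide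
  simp [Perm3, Fin.forall_fin_succ, h]

lemma Perm3_swap12_entry : Perm3 d (Equiv.swap 1 2) i j =
    if i 0 = j 0 ∧ i 1 = j 2 ∧ i 2 = j 1 then 1 else 0 := by
  have h : (Equiv.swap (1 : Fin 3) 2) 0 = 0 := by decide
  simp [Perm3, Fin.forall_fin_succ, h]

lemma Perm3_rotate_entry : Perm3 d (finRotate 3) i j =
    if i 0 = j 2 ∧ i 1 = j 0 ∧ i 2 = j 1 then 1 else 0 := by
  have h : (-1 : Fin 3) = 2 := rfl
  simp [Perm3, Fin.forall_fin_succ, h]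

lemma Perm3_rotate_inv_entry : Perm3 d (finRotate 3)⁻¹ i j =
    if i 0 = j 1 ∧ i 1 = j 2 ∧ i 2 = j 0 then 1 else 0 := by
  simp [Perm3, Fin.forall_fin_succ]

end Entries

lemma Perm3_one (d : ℕ) : Perm3 d 1 = 1 := by
  ext i j
  simp [Perm3, Matrix.one_apply, funext_iff]

lemma projSym3_eq (d : ℕ) : projSym3 d = (6 : ℂ)⁻¹ • (1 + Perm3 d (Equiv.swap 0 1)
    + Perm3 d (Equiv.swap 0 2) + Perm3 d (Equiv.swap 1 2)
    + Perm3 d (finRotate 3) + Perm3 d (finRotate 3)⁻¹) := by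
  have h : (Finset.univ : Finset (Equiv.Perm (Fin 3))) = {1, Equiv.swap 0 1, Equiv.swap 0 2,
      Equiv.swap 1 2, finRotate 3, (finRotate 3)⁻¹} := by decide
  rw [projSym3, h]
  repeat rw [Finset.sum_insert (by decide)]
  rw [Finset.sum_singleton, Perm3_one]
  simp only [add_assoc]

/-! ### The depolarizing map on permutation operators -/

section Depolarizing

variable {d : ℕ} (δ : ℝ)

lemma depOn_zero_one (hd : d ≠ 0) : depOn d δ 0 1 = 1 := by
  have hd' : (d : ℂ) ≠ 0 := by exact_mod_cast hd
  ext i j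
  by_cases h : i 0 = j 0 <;> by_cases h1 : i 1 = j 1 <;> by_cases h2 : i 2 = j 2 <;>
    simp [depOn, one_entry, h, h1, h2]
  field_simp
  ring

lemma depOn_one_one (hd : d ≠ 0) : depOn d δ 1 1 = 1 := by
  have hd' : (d : ℂ) ≠ 0 := by exact_mod_cast hd
  ext i j
  by_cases h : i 0 = j 0 <;> by_cases h1 : i 1 = j 1 <;> by_cases h2 : i 2 = j 2 <;>
    simp [depOn, one_entry, h, h1, h2]
  field_simp
  ring

lemma depOn_zero_swap01 : depOn d δ 0 (Perm3 d (Equiv.swap 0 1)) =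
    (1 - δ : ℂ) • Perm3 d (Equiv.swap 0 1) + (δ / d : ℂ) • 1 := by
  ext i j
  simp [depOn, one_entry, Perm3_swap01_entry, ite_and]

lemma depOn_one_swap01 : depOn d δ 1 (Perm3 d (Equiv.swap 0 1)) =
    (1 - δ : ℂ) • Perm3 d (Equiv.swap 0 1) + (δ / d : ℂ) • 1 := by
  ext i j
  simp [depOn, one_entry, Perm3_swap01_entry, ite_and]
  grind

lemma depOn_zero_swap02 : depOn d δ 0 (Perm3 d (Equiv.swap 0 2)) =
    (1 - δ : ℂ) • Perm3 d (Equiv.swap 0 2) + (δ / d : ℂ) • 1 := by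
  ext i j
  simp [depOn, one_entry, Perm3_swap02_entry, ite_and]

lemma depOn_one_swap12 : depOn d δ 1 (Perm3 d (Equiv.swap 1 2)) =
    (1 - δ : ℂ) • Perm3 d (Equiv.swap 1 2) + (δ / d : ℂ) • 1 := by
  ext i j
  simp [depOn, one_entry, Perm3_swap12_entry, ite_and]
  grind

lemma depOn_one_swap02 (hd : d ≠ 0) :
    depOn d δ 1 (Perm3 d (Equiv.swap 0 2)) = Perm3 d (Equiv.swap 0 2) := by
  have hd' : (d : ℂ) ≠ 0 := by exact_mod_cast hd
  ext i j
  by_cases h : i 0 = j 2 <;> by_cases h1 : i 1 = j 1 <;> by_cases h2 : i 2 = j 0 <;>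
    simp [depOn, Perm3_swap02_entry, h, h1, h2]
  field_simp
  ring

lemma depOn_zero_swap12 (hd : d ≠ 0) :
    depOn d δ 0 (Perm3 d (Equiv.swap 1 2)) = Perm3 d (Equiv.swap 1 2) := by
  have hd' : (d : ℂ) ≠ 0 := by exact_mod_cast hd
  ext i j
  by_cases h : i 0 = j 0 <;> by_cases h1 : i 1 = j 2 <;> by_cases h2 : i 2 = j 1 <;>
    simp [depOn, Perm3_swap12_entry, h, h1, h2]
  field_simp
  ring

lemma depOn_one_rotate : depOn d δ 1 (Perm3 d (finRotate 3)) =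
    (1 - δ : ℂ) • Perm3 d (finRotate 3) + (δ / d : ℂ) • Perm3 d (Equiv.swap 0 2) := by
  ext i j
  simp [depOn, Perm3_rotate_entry, Perm3_swap02_entry, ite_and]
  grind

lemma depOn_one_rotate_inv : depOn d δ 1 (Perm3 d (finRotate 3)⁻¹) =
    (1 - δ : ℂ) • Perm3 d (finRotate 3)⁻¹ + (δ / d : ℂ) • Perm3 d (Equiv.swap 0 2) := by
  ext i j
  simp only [depOn, Matrix.of_apply, Matrix.add_apply, Matrix.smul_apply, Perm3_rotate_inv_entry,
    Perm3_swap02_entry]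
  simp [ite_and]
  grind

lemma depOn_zero_rotate : depOn d δ 0 (Perm3 d (finRotate 3)) =
    (1 - δ : ℂ) • Perm3 d (finRotate 3) + (δ / d : ℂ) • Perm3 d (Equiv.swap 1 2) := by
  ext i j
  simp [depOn, Perm3_rotate_entry, Perm3_swap12_entry, ite_and]

lemma depOn_zero_rotate_inv : depOn d δ 0 (Perm3 d (finRotate 3)⁻¹) =
    (1 - δ : ℂ) • Perm3 d (finRotate 3)⁻¹ + (δ / d : ℂ) • Perm3 d (Equiv.swap 1 2) := by
  ext i j
  simp only [depOn, Matrix.of_apply, Matrix.add_apply, Matrix.smul_apply, Perm3_rotate_inv_entry,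
    Perm3_swap12_entry]
  simp [ite_and]

end Depolarizing

/-! ### Partial transposes through maximally entangled vectors -/

/-- The map `x ↦ ∑ k, e_k ⊗ x ⊗ e_k`. -/
def entangle02 (d : ℕ) : Matrix (Idx d) (Fin d) ℂ :=
  Matrix.of fun i x => if i 0 = i 2 ∧ i 1 = x then 1 else 0

/-- The map `x ↦ ∑ k, x ⊗ e_k ⊗ e_k`. -/
def entangle12 (d : ℕ) : Matrix (Idx d) (Fin d) ℂ :=
  Matrix.of fun i x => if i 1 = i 2 ∧ i 0 = x then 1 else 0

section PartialTranspose

variable (d : ℕ)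

lemma entangle02_vec (a b c x : Fin d) :
    entangle02 d ![a, b, c] x = if a = c ∧ b = x then 1 else 0 := rfl

lemma entangle12_vec (a b c x : Fin d) :
    entangle12 d ![a, b, c] x = if b = c ∧ a = x then 1 else 0 := rfl

lemma pt3_one : pt3 d 1 = 1 := by
  ext i j
  simp [pt3, one_entry, eq_comm]

lemma pt3_swap01 : pt3 d (Perm3 d (Equiv.swap 0 1)) = Perm3 d (Equiv.swap 0 1) := by
  ext i j
  simp [pt3, Perm3_swap01_entry, eq_comm]

lemma pt3_swap02 :
    pt3 d (Perm3 d (Equiv.swap 0 2)) = entangle02 d * (entangle02 d)ᴴ := by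
  ext i j
  simp [pt3, Perm3_swap02_entry, entangle02, Matrix.mul_apply, ite_and, apply_ite]
  grind

lemma pt3_swap12 :
    pt3 d (Perm3 d (Equiv.swap 1 2)) = entangle12 d * (entangle12 d)ᴴ := by
  ext i j
  simp [pt3, Perm3_swap12_entry, entangle12, Matrix.mul_apply, ite_and, apply_ite]
  grind

lemma pt3_rotate :
    pt3 d (Perm3 d (finRotate 3)) = entangle02 d * (entangle12 d)ᴴ := by
  ext i j
  simp [pt3, Perm3_rotate_entry, entangle02, entangle12, Matrix.mul_apply, ite_and, apply_ite]
  grind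

lemma pt3_rotate_inv :
    pt3 d (Perm3 d (finRotate 3)⁻¹) = entangle12 d * (entangle02 d)ᴴ := by
  ext i j
  simp only [pt3, Matrix.of_apply, Perm3_rotate_inv_entry]
  simp [entangle02, entangle12, Matrix.mul_apply, ite_and, apply_ite]
  grind

/-- Sums over `Idx d` as iterated sums over the three tensor factors. -/
lemma sum_Idx (g : Idx d → ℂ) : ∑ i, g i = ∑ a, ∑ b, ∑ c, g ![a, b, c] := by
  rw [← (Fin.consEquiv fun _ : Fin 3 => Fin d).sum_comp, Fintype.sum_prod_type]
  refine Finset.sum_congr rfl fun a _ => ?_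
  rw [← (Fin.consEquiv fun _ : Fin 2 => Fin d).sum_comp, Fintype.sum_prod_type]
  refine Finset.sum_congr rfl fun b _ => ?_
  rw [← (Equiv.funUnique (Fin 1) (Fin d)).symm.sum_comp]
  refine Finset.sum_congr rfl fun c _ => congrArg g ?_
  ext k
  fin_cases k <;> rfl

lemma swap01_mul_apply {n : Type*} (A : Matrix (Idx d) n ℂ) (i : Idx d) (x : n) :
    (Perm3 d (Equiv.swap 0 1) * A) i x = A ![i 1, i 0, i 2] x := by
  rw [Matrix.mul_apply, Finset.sum_eq_single ![i 1, i 0, i 2]]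
  · simp [Perm3_swap01_entry]
  · intro j _ hj
    rw [Perm3_swap01_entry, if_neg, zero_mul]
    rintro ⟨h0, h1, h2⟩
    refine hj (funext fun k => ?_)
    fin_cases k <;> simp [h0, h1, h2]
  · simp

lemma swap01_mul_self : Perm3 d (Equiv.swap 0 1) * Perm3 d (Equiv.swap 0 1) = 1 := by
  ext i j
  simp [swap01_mul_apply, Perm3_swap01_entry, one_entry]
  grind

lemma swap01_conjTranspose : (Perm3 d (Equiv.swap 0 1))ᴴ = Perm3 d (Equiv.swap 0 1) := by
  ext i j
  simp [Perm3_swap01_entry, apply_ite]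
  grind

lemma swap01_mul_entangle02 : Perm3 d (Equiv.swap 0 1) * entangle02 d = entangle12 d := by
  ext i x
  simp [swap01_mul_apply, entangle02, entangle12]
  grind

lemma swap01_mul_entangle12 : Perm3 d (Equiv.swap 0 1) * entangle12 d = entangle02 d := by
  rw [← swap01_mul_entangle02, ← Matrix.mul_assoc, swap01_mul_self, Matrix.one_mul]

lemma entangle02_conjTranspose_mul_self :
    (entangle02 d)ᴴ * entangle02 d = (d : ℂ) • 1 := by
  ext x y
  simp [Matrix.mul_apply, sum_Idx, entangle02_vec, ite_and, apply_ite, Matrix.one_apply]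
  grind

lemma entangle12_conjTranspose_mul_self :
    (entangle12 d)ᴴ * entangle12 d = (d : ℂ) • 1 := by
  ext x y
  simp [Matrix.mul_apply, sum_Idx, entangle12_vec, ite_and, apply_ite, Matrix.one_apply]
  grind

lemma entangle02_conjTranspose_mul_entangle12 :
    (entangle02 d)ᴴ * entangle12 d = 1 := by
  ext x y
  simp [Matrix.mul_apply, sum_Idx, entangle02_vec, entangle12_vec, ite_and, apply_ite, Matrix.one_apply]
  grind

lemma entangle12_conjTranspose_mul_entangle02 :
    (entangle12 d)ᴴ * entangle02 d = 1 := by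
  have h := congrArg Matrix.conjTranspose (entangle02_conjTranspose_mul_entangle12 d)
  simpa [Matrix.conjTranspose_mul] using h

end PartialTranspose

/-! ### Positivity -/

/-- If `S / 2` is an orthogonal projection whose range contains that of `W`, and `WᴴW = 2t`, then
`t S - W Wᴴ` is a nonnegative multiple of an orthogonal projection. -/
lemma posSemidef_smul_sub_mul_conjTranspose {m n : Type*} [Fintype m] [Fintype n] [DecidableEq n]
    (S : Matrix m m ℂ) (W : Matrix m n ℂ) (t : ℝ) (ht : 0 < t) (hS : Sᴴ = S)
    (hSS : S * S = (2 : ℂ) • S) (hSW : S * W = (2 : ℂ) • W) (hWW : Wᴴ * W = (2 * t : ℂ) • 1) :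
    ((t : ℂ) • S - W * Wᴴ).PosSemidef := by
  set X := (t : ℂ) • S - W * Wᴴ with hX
  have hXH : Xᴴ = X := by
    simp [hX, Matrix.conjTranspose_mul, hS]
  have hWS : Wᴴ * S = (2 : ℂ) • Wᴴ := by
    have h := congrArg Matrix.conjTranspose hSW
    simpa [Matrix.conjTranspose_mul, hS] using h
  have hWWS : W * Wᴴ * S = (2 : ℂ) • (W * Wᴴ) := by
    rw [Matrix.mul_assoc, hWS, Matrix.mul_smul]
  have hSWW : S * (W * Wᴴ) = (2 : ℂ) • (W * Wᴴ) := by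
    rw [← Matrix.mul_assoc, hSW, Matrix.smul_mul]
  have hWWWW : W * Wᴴ * (W * Wᴴ) = (2 * t : ℂ) • (W * Wᴴ) := by
    rw [Matrix.mul_assoc, ← Matrix.mul_assoc Wᴴ, hWW]
    simp
  have hXX : Xᴴ * X = (2 * t : ℂ) • X := by
    rw [hXH, hX]
    simp only [Matrix.sub_mul, Matrix.mul_sub, Matrix.smul_mul, Matrix.mul_smul, hSS, hWWS, hSWW,
      hWWWW]
    module
  have ht' : (2 * t : ℂ) ≠ 0 := by
    simpa using ht.ne'
  have hpos : (0 : ℝ) ≤ (2 * t)⁻¹ := by positivity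
  have h := (Matrix.posSemidef_conjTranspose_mul_self X).smul hpos
  rw [hXX] at h
  convert h using 1
  ext i j
  simp only [Matrix.smul_apply, Complex.real_smul, smul_eq_mul]
  push_cast
  field_simp

lemma posSemidef_symmetric_sub (d : ℕ) :
    (((d + 1 : ℝ) : ℂ) • (1 + Perm3 d (Equiv.swap 0 1)) -
      (entangle02 d + entangle12 d) * (entangle02 d + entangle12 d)ᴴ).PosSemidef := by
  apply posSemidef_smul_sub_mul_conjTranspose _ _ _ (by positivity)
  · simp [swap01_conjTranspose]
  · simp only [Matrix.add_mul, Matrix.mul_add, swap01_mul_self, Matrix.one_mul, Matrix.mul_one]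
    module
  · simp only [Matrix.add_mul, Matrix.mul_add, swap01_mul_entangle02, swap01_mul_entangle12,
      Matrix.one_mul]
    module
  · simp only [Matrix.conjTranspose_add, Matrix.add_mul, Matrix.mul_add,
      entangle02_conjTranspose_mul_self, entangle12_conjTranspose_mul_self,
      entangle02_conjTranspose_mul_entangle12, entangle12_conjTranspose_mul_entangle02]
    push_cast
    module

lemma posSemidef_antisymmetric_sub (d : ℕ) (hd : 2 ≤ d) :
    (((d - 1 : ℝ) : ℂ) • (1 - Perm3 d (Equiv.swap 0 1)) -
      (entangle02 d - entangle12 d) * (entangle02 d - entangle12 d)ᴴ).PosSemidef := by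
  have hd' : (2 : ℝ) ≤ d := by exact_mod_cast hd
  apply posSemidef_smul_sub_mul_conjTranspose _ _ _ (by linarith)
  · simp [swap01_conjTranspose]
  · simp only [Matrix.sub_mul, Matrix.mul_sub, swap01_mul_self, Matrix.one_mul, Matrix.mul_one]
    module
  · simp only [Matrix.sub_mul, Matrix.mul_sub, swap01_mul_entangle02, swap01_mul_entangle12,
      Matrix.one_mul]
    module
  · simp only [Matrix.conjTranspose_sub, Matrix.sub_mul, Matrix.mul_sub,
      entangle02_conjTranspose_mul_self, entangle12_conjTranspose_mul_self,
      entangle02_conjTranspose_mul_entangle12, entangle12_conjTranspose_mul_entangle02]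
    push_cast
    module

/-! ### Normalizations -/

lemma Dnd_two (d : ℕ) : (Dnd 2 d : ℂ) = d * (d + 1) / 2 := by
  have h : 2 * Dnd 2 d = d * (d + 1) := by
    have h1 := Nat.ascFactorial_eq_factorial_mul_choose' d 2
    have h2 : 2 + d - 1 = d + 1 := by omega
    rw [Dnd, h2]
    simp [Nat.ascFactorial, Nat.factorial] at h1
    linarith
  have h' : (2 : ℂ) * Dnd 2 d = d * (d + 1) := by exact_mod_cast h
  linear_combination h' / 2

lemma Dnd_three (d : ℕ) : (Dnd 3 d : ℂ) = d * (d + 1) * (d + 2) / 6 := by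
  have h : 6 * Dnd 3 d = d * (d + 1) * (d + 2) := by
    have h1 := Nat.ascFactorial_eq_factorial_mul_choose' d 3
    have h2 : 3 + d - 1 = d + 2 := by omega
    rw [Dnd, h2]
    simp [Nat.ascFactorial, Nat.factorial] at h1
    linarith
  have h' : (6 : ℂ) * Dnd 3 d = d * (d + 1) * (d + 2) := by exact_mod_cast h
  linear_combination h' / 6

lemma Rop_eq (d : ℕ) (hd : d ≠ 0) (δ : ℝ) :
    Rop d δ = (d * (d + 1) : ℂ)⁻¹ • ((1 + (2 - δ) * (δ / d) : ℂ) • 1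
      + ((1 - δ) ^ 2 : ℂ) • Perm3 d (Equiv.swap 0 1)) := by
  rw [Rop, Dnd_two, inv_div, div_eq_mul_inv]
  simp only [depOn_add, depOn_smul, depOn_one_one δ hd, depOn_zero_one δ hd, depOn_one_swap01,
    depOn_zero_swap01]
  module

lemma Qop_eq (d : ℕ) (hd : d ≠ 0) (δ : ℝ) :
    Qop d δ = (d * (d + 1) * (d + 2) : ℂ)⁻¹ •
      ((1 + (2 - δ) * (δ / d) + 2 * (δ / d) + 2 * (δ / d) ^ 2 : ℂ) • 1
      + ((1 - δ) ^ 2 : ℂ) • Perm3 d (Equiv.swap 0 1)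
      + ((1 - δ) * (1 + 2 * (δ / d)) : ℂ) •
        (Perm3 d (Equiv.swap 0 2) + Perm3 d (Equiv.swap 1 2))
      + ((1 - δ) ^ 2 : ℂ) • (Perm3 d (finRotate 3) + Perm3 d (finRotate 3)⁻¹)) := by
  rw [Qop, Dnd_three, projSym3_eq, inv_div, div_eq_mul_inv]
  simp only [depOn_add, depOn_smul, depOn_one_one δ hd, depOn_zero_one δ hd, depOn_one_swap01,
    depOn_zero_swap01, depOn_zero_swap02, depOn_one_swap02 δ hd, depOn_one_swap12,
    depOn_zero_swap12 δ hd, depOn_one_rotate, depOn_one_rotate_inv, depOn_zero_rotate,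
    depOn_zero_rotate_inv]
  module

/-- The operator λ₀·R^{T₃} − Q^{T₃} + C^{T₃} is positive semidefinite for δ ∈ [0,1],
where C = 2α·I − α·(P((123)) + P((132))) and α = (1−δ)δ(d(δ−1)−δ)/(d³(d+1)). -/
theorem lam0_R_sub_Q_add_C_pt3_posSemidef
    (d : ℕ) (hd : 2 ≤ d) (δ : ℝ) (hδ : δ ∈ Set.Icc (0 : ℝ) 1) (α : ℝ)
    (hα : α = (1 - δ) * δ * ((d : ℝ) * (δ - 1) - δ) / ((d : ℝ) ^ 3 * ((d : ℝ) + 1))) :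
    ((1 - ((d : ℝ) - 1) * δ / d) • pt3 d (Rop d δ) - pt3 d (Qop d δ)
      + pt3 d ((2 * α) • (1 : Matrix (Idx d) (Idx d) ℂ)
          - α • (Perm3 d (finRotate 3) + Perm3 d (finRotate 3)⁻¹))).PosSemidef := by
  obtain ⟨h0, h1⟩ := hδ
  have hd0 : d ≠ 0 := by omega
  have hd2 : (2 : ℝ) ≤ d := by exact_mod_cast hd
  have hdpos : (0 : ℝ) < d := by linarith
  have hfrac : 0 ≤ δ / d := by positivity
  have hfd : δ / d * d = δ := by field_simp
  have hlam0 : 0 ≤ 1 - δ + δ / d := by linarith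
  have hlam1 : 1 - δ + δ / d ≤ 1 := by nlinarith
  set N : ℝ := d * (d + 1) * (d + 2) with hN
  have hNpos : 0 < N := by positivity
  set p : ℝ := (1 - δ) * (2 - δ + 2 * (δ / d) - (δ + 2 * (δ / d)) * (1 - δ + δ / d)) / (2 * N)
    with hp
  set q : ℝ := (1 - δ) * (δ + 2 * (δ / d) + (δ + 2 * (δ / d)) * (1 - δ + δ / d)) / (2 * N)
    with hq
  have hp0 : 0 ≤ p := by
    refine div_nonneg (mul_nonneg (by linarith) ?_) (by positivity)
    nlinarith [mul_le_mul_of_nonneg_left hlam1 (by positivity : 0 ≤ δ + 2 * (δ / d))]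
  have hq0 : 0 ≤ q := by
    refine div_nonneg (mul_nonneg (by linarith) ?_) (by positivity)
    positivity
  have hsum := ((posSemidef_symmetric_sub d).smul hp0).add
    ((posSemidef_antisymmetric_sub d hd).smul hq0)
  convert hsum using 1
  rw [Rop_eq d hd0, Qop_eq d hd0]
  simp only [pt3_add, pt3_sub, pt3_smul, pt3_one, pt3_swap01, pt3_swap02, pt3_swap12, pt3_rotate,
    pt3_rotate_inv, Matrix.conjTranspose_add, Matrix.conjTranspose_sub, Matrix.add_mul,
    Matrix.mul_add, Matrix.sub_mul, Matrix.mul_sub]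
  have hdC : (d : ℂ) ≠ 0 := by exact_mod_cast hd0
  have hdC1 : (d : ℂ) + 1 ≠ 0 := by exact_mod_cast (by omega : d + 1 ≠ 0)
  have hdC2 : (d : ℂ) + 2 ≠ 0 := by exact_mod_cast (by omega : d + 2 ≠ 0)
  rw [hp, hq, hα, hN]
  ext i j
  simp only [Matrix.add_apply, Matrix.sub_apply, Matrix.smul_apply, Complex.real_smul, smul_eq_mul]
  push_cast
  field_simp
  ring
end
end
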